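/- arXiv:2410.22114 — 2 statements merged into one kernel-verified Lean document; each statement's English description precedes it below -/
import Mathlib

section
/- Transition gradient theorem: fix a policy π ∈ Π and let ξ ↦ p^ξ be a map from ℝ^d to transition kernels such that each coordinate function ξ ↦ p^ξ_{sas'} is differentiable. Then ξ ↦ J_ρ(π, p^ξ) is differentiable, and its gradient equals ∇_ξ J_ρ(π, p^ξ) = (1/(1−γ)) Σ_s d^{π,p^ξ}_ρ(s) Σ_a π_{sa} Σ_{s'} ∇_ξ p^ξ_{sas'} · (c_{sas'} + γ v^{π,p^ξ}_{s'}). -/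
open scoped BigOperators

noncomputable section

namespace RMDPStmt

variable {S A : ℕ}

/-- `p` is a transition kernel: each `p s a` lies in the probability simplex `Δ^S`. -/
def IsKernel (p : Fin S → Fin A → Fin S → ℝ) : Prop :=
  ∀ s a, p s a ∈ stdSimplex ℝ (Fin S)

/-- `π` is a stationary randomized policy: each `π s` lies in the simplex `Δ^A`. -/
def IsPolicy (π : Fin S → Fin A → ℝ) : Prop :=
  ∀ s, π s ∈ stdSimplex ℝ (Fin A)

/-- The state-to-state matrix `P^π`. -/
def Pmat (π : Fin S → Fin A → ℝ) (p : Fin S → Fin A → Fin S → ℝ) :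
    Matrix (Fin S) (Fin S) ℝ :=
  Matrix.of fun s s' => ∑ a, π s a * p s a s'

/-- The expected one-step cost vector `c^π`. -/
def cvec (c : Fin S → Fin A → Fin S → ℝ) (π : Fin S → Fin A → ℝ)
    (p : Fin S → Fin A → Fin S → ℝ) : Fin S → ℝ :=
  fun s => ∑ a, π s a * ∑ s', p s a s' * c s a s'

/-- Value function `v^{π,p}` as a discounted series. -/
def value (γ : ℝ) (c : Fin S → Fin A → Fin S → ℝ) (π : Fin S → Fin A → ℝ)
    (p : Fin S → Fin A → Fin S → ℝ) : Fin S → ℝ :=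
  fun s => ∑' t : ℕ, γ ^ t * ((Pmat π p ^ t).mulVec (cvec c π p)) s

/-- The return `J_ρ(π,p)`. -/
def J (γ : ℝ) (c : Fin S → Fin A → Fin S → ℝ) (ρ : Fin S → ℝ)
    (π : Fin S → Fin A → ℝ) (p : Fin S → Fin A → Fin S → ℝ) : ℝ :=
  ∑ s, ρ s * value γ c π p s

/-- The action-value function `q^{π,p}`. -/
def qval (γ : ℝ) (c : Fin S → Fin A → Fin S → ℝ) (π : Fin S → Fin A → ℝ)
    (p : Fin S → Fin A → Fin S → ℝ) : Fin S → Fin A → ℝ :=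
  fun s a => ∑ s', p s a s' * (c s a s' + γ * value γ c π p s')

/-- The discounted state occupancy measure `d^{π,p}_ρ`. -/
def occ (γ : ℝ) (ρ : Fin S → ℝ) (π : Fin S → Fin A → ℝ)
    (p : Fin S → Fin A → Fin S → ℝ) : Fin S → ℝ :=
  fun s' => (1 - γ) * ∑' t : ℕ, γ ^ t * ∑ s, ρ s * (Pmat π p ^ t) s s'

/-- Bregman divergence generated by `h`. -/
def breg {E : Type*} [NormedAddCommGroup E] [NormedSpace ℝ E]
    (h : E → ℝ) (x y : E) : ℝ :=
  h x - h y - fderiv ℝ h y (x - y)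

/-- Weighted Bregman divergence `B_μ`. -/
def bregW {E : Type*} [NormedAddCommGroup E] [NormedSpace ℝ E]
    (μ : Fin S → ℝ) (h : E → ℝ) (x y : Fin S → E) : ℝ :=
  ∑ s, μ s * breg h (x s) (y s)

/-- Inner product of two action-indexed vectors. -/
def dotA (u v : Fin A → ℝ) : ℝ := ∑ a, u a * v a

/-- Inner product of two action-by-state arrays. -/
def dotAS (u v : Fin A → Fin S → ℝ) : ℝ := ∑ a, ∑ s', u a s' * v a s'

/-- The robust objective `Φ(π) = sup_{p ∈ Amb} J_ρ(π,p)`. -/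
def Phi (γ : ℝ) (c : Fin S → Fin A → Fin S → ℝ) (ρ : Fin S → ℝ)
    (Amb : Set (Fin S → Fin A → Fin S → ℝ)) (π : Fin S → Fin A → ℝ) : ℝ :=
  sSup ((fun p => J γ c ρ π p) '' Amb)

/-- The distribution mismatch coefficient
`M = sup_{π ∈ Π, p ∈ Amb} max_s d^{π,p}_ρ(s)/ρ_s`. -/
def mismatch (γ : ℝ) (ρ : Fin S → ℝ)
    (Amb : Set (Fin S → Fin A → Fin S → ℝ)) : ℝ :=
  sSup {x : ℝ | ∃ (π : Fin S → Fin A → ℝ) (p : Fin S → Fin A → Fin S → ℝ),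
    IsPolicy π ∧ p ∈ Amb ∧ ∃ s, x = occ γ ρ π p s / ρ s}


open Filter Topology Asymptotics Matrix

/-- The discounted potential matrix `∑ₜ γᵗ Pᵗ`, taken entrywise. -/
def potential (γ : ℝ) (P : Matrix (Fin S) (Fin S) ℝ) : Matrix (Fin S) (Fin S) ℝ :=
  Matrix.of fun s s' => ∑' t : ℕ, γ ^ t * (P ^ t) s s'

lemma Pmat_mem_rowStochastic {π : Fin S → Fin A → ℝ} {p : Fin S → Fin A → Fin S → ℝ}
    (hπ : IsPolicy π) (hp : IsKernel p) : Pmat π p ∈ rowStochastic ℝ (Fin S) := by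
  refine mem_rowStochastic_iff_sum.2 ⟨fun s s' => ?_, fun s => ?_⟩
  · rw [Pmat, of_apply]
    exact Finset.sum_nonneg fun a _ => mul_nonneg ((hπ s).1 a) ((hp s a).1 s')
  · simp only [Pmat, of_apply]
    rw [Finset.sum_comm]
    simp_rw [← Finset.mul_sum, (hp s _).2, mul_one, (hπ s).2]

lemma norm_pow_mul_pow_apply_le {γ : ℝ} (hγ : 0 ≤ γ) {P : Matrix (Fin S) (Fin S) ℝ}
    (hP : P ∈ rowStochastic ℝ (Fin S)) (t : ℕ) (s s' : Fin S) :
    ‖γ ^ t * (P ^ t) s s'‖ ≤ γ ^ t := by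
  have h := pow_mem hP t
  rw [Real.norm_of_nonneg (mul_nonneg (pow_nonneg hγ t) (nonneg_of_mem_rowStochastic h))]
  exact mul_le_of_le_one_right (pow_nonneg hγ t) (le_one_of_mem_rowStochastic h)

lemma summable_pow_mul_pow_apply {γ : ℝ} (hγ : γ ∈ Set.Ioo (0 : ℝ) 1)
    {P : Matrix (Fin S) (Fin S) ℝ} (hP : P ∈ rowStochastic ℝ (Fin S)) (s s' : Fin S) :
    Summable fun t : ℕ => γ ^ t * (P ^ t) s s' :=
  .of_norm_bounded (summable_geometric_of_lt_one hγ.1.le hγ.2)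
    fun t => norm_pow_mul_pow_apply_le hγ.1.le hP t s s'

lemma potential_eq_one_add {γ : ℝ} (hγ : γ ∈ Set.Ioo (0 : ℝ) 1)
    {P : Matrix (Fin S) (Fin S) ℝ} (hP : P ∈ rowStochastic ℝ (Fin S)) :
    potential γ P = 1 + γ • (potential γ P * P) := by
  ext s s'
  have hs := summable_pow_mul_pow_apply hγ hP s
  rw [potential, of_apply, (hs s').tsum_eq_zero_add]
  simp only [pow_zero, one_mul, Matrix.add_apply, Matrix.smul_apply, mul_apply, of_apply, smul_eq_mul]
  simp_rw [← tsum_mul_right]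
  rw [← Summable.tsum_finsetSum fun i _ => (hs i).mul_right _, ← tsum_mul_left]
  congr 2
  funext t
  rw [pow_succ, pow_succ, mul_apply, Finset.mul_sum, Finset.mul_sum]
  exact Finset.sum_congr rfl fun i _ => by ring

lemma potential_mul_one_sub {γ : ℝ} (hγ : γ ∈ Set.Ioo (0 : ℝ) 1)
    {P : Matrix (Fin S) (Fin S) ℝ} (hP : P ∈ rowStochastic ℝ (Fin S)) :
    potential γ P * (1 - γ • P) = 1 := by
  rw [mul_sub, mul_one, mul_smul_comm, sub_eq_iff_eq_add]
  exact potential_eq_one_add hγ hP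

lemma value_eq_potential_mulVec {γ : ℝ} (hγ : γ ∈ Set.Ioo (0 : ℝ) 1)
    (c : Fin S → Fin A → Fin S → ℝ) {π : Fin S → Fin A → ℝ} {p : Fin S → Fin A → Fin S → ℝ}
    (hP : Pmat π p ∈ rowStochastic ℝ (Fin S)) :
    value γ c π p = potential γ (Pmat π p) *ᵥ cvec c π p := by
  funext s
  have hs := summable_pow_mul_pow_apply hγ hP s
  simp only [value, potential, mulVec, dotProduct, of_apply]
  simp_rw [← tsum_mul_right]
  rw [← Summable.tsum_finsetSum fun i _ => (hs i).mul_right _]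
  congr 1
  funext t
  rw [Finset.mul_sum]
  exact Finset.sum_congr rfl fun i _ => by ring

lemma occ_eq_vecMul_potential {γ : ℝ} (hγ : γ ∈ Set.Ioo (0 : ℝ) 1) (ρ : Fin S → ℝ)
    {π : Fin S → Fin A → ℝ} {p : Fin S → Fin A → Fin S → ℝ}
    (hP : Pmat π p ∈ rowStochastic ℝ (Fin S)) (s : Fin S) :
    occ γ ρ π p s = (1 - γ) * (ρ ᵥ* potential γ (Pmat π p)) s := by
  have hs := fun i => summable_pow_mul_pow_apply hγ hP i s
  simp only [occ, potential, vecMul, dotProduct, of_apply]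
  simp_rw [← tsum_mul_left (a := ρ _)]
  rw [← Summable.tsum_finsetSum fun i _ => (hs i).mul_left _]
  congr 2
  funext t
  rw [Finset.mul_sum]
  exact Finset.sum_congr rfl fun i _ => by ring

/-- One-step lookahead at state `s` under `p`, with continuation values `v`. -/
def lookahead (γ : ℝ) (c : Fin S → Fin A → Fin S → ℝ) (π : Fin S → Fin A → ℝ)
    (v : Fin S → ℝ) (p : Fin S → Fin A → Fin S → ℝ) (s : Fin S) : ℝ :=
  ∑ a, π s a * ∑ s', (c s a s' + γ * v s') * p s a s'

lemma lookahead_eq (γ : ℝ) (c : Fin S → Fin A → Fin S → ℝ) (π : Fin S → Fin A → ℝ)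
    (v : Fin S → ℝ) (p : Fin S → Fin A → Fin S → ℝ) :
    lookahead γ c π v p = cvec c π p + (γ • Pmat π p) *ᵥ v := by
  funext s
  simp only [lookahead, cvec, Pmat, mulVec, dotProduct, Pi.add_apply, Matrix.smul_apply, of_apply,
    smul_eq_mul, Finset.mul_sum, Finset.sum_mul]
  conv_rhs =>
    arg 2
    rw [Finset.sum_comm]
  rw [← Finset.sum_add_distrib]
  refine Finset.sum_congr rfl fun i _ => ?_
  rw [← Finset.sum_add_distrib]
  exact Finset.sum_congr rfl fun a _ => by ring

/-- Bellman equation for the value function. -/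
lemma lookahead_value {γ : ℝ} (hγ : γ ∈ Set.Ioo (0 : ℝ) 1)
    (c : Fin S → Fin A → Fin S → ℝ) {π : Fin S → Fin A → ℝ} {p : Fin S → Fin A → Fin S → ℝ}
    (hP : Pmat π p ∈ rowStochastic ℝ (Fin S)) :
    lookahead γ c π (value γ c π p) p = value γ c π p := by
  have h := mul_eq_one_comm.1 (potential_mul_one_sub hγ hP)
  have h' : (1 - γ • Pmat π p) *ᵥ value γ c π p = cvec c π p := by
    rw [value_eq_potential_mulVec hγ c hP, mulVec_mulVec, h, one_mulVec]
  rw [sub_mulVec, one_mulVec] at h'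
  rw [lookahead_eq, ← h', sub_add_cancel]

/-- Performance difference between two kernels. -/
lemma J_eq_add_sum {γ : ℝ} (hγ : γ ∈ Set.Ioo (0 : ℝ) 1)
    (c : Fin S → Fin A → Fin S → ℝ) (ρ : Fin S → ℝ) {π : Fin S → Fin A → ℝ}
    {p q : Fin S → Fin A → Fin S → ℝ} (hp : Pmat π p ∈ rowStochastic ℝ (Fin S))
    (hq : Pmat π q ∈ rowStochastic ℝ (Fin S)) :
    J γ c ρ π p = J γ c ρ π q + ∑ s, (ρ ᵥ* potential γ (Pmat π p)) s *
      (lookahead γ c π (value γ c π q) p s - lookahead γ c π (value γ c π q) q s) := by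
  set v := value γ c π q
  have hv : potential γ (Pmat π p) *ᵥ (v - (γ • Pmat π p) *ᵥ v) = v := by
    have h : v - (γ • Pmat π p) *ᵥ v = (1 - γ • Pmat π p) *ᵥ v := by
      rw [sub_mulVec, one_mulVec]
    rw [h, mulVec_mulVec, potential_mul_one_sub hγ hp, one_mulVec]
  have hc : cvec c π p = (lookahead γ c π v p - v) + (v - (γ • Pmat π p) *ᵥ v) := by
    rw [lookahead_eq]; abel
  have hval : value γ c π p = potential γ (Pmat π p) *ᵥ (lookahead γ c π v p - v) + v := by
    rw [value_eq_potential_mulVec hγ c hp, hc, mulVec_add, hv]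
  rw [lookahead_value hγ c hq]
  change ρ ⬝ᵥ value γ c π p =
    ρ ⬝ᵥ v + ρ ᵥ* potential γ (Pmat π p) ⬝ᵥ (lookahead γ c π v p - v)
  rw [hval, dotProduct_add, dotProduct_mulVec, add_comm]

lemma continuous_vecMul_potential {X : Type*} [TopologicalSpace X] {γ : ℝ}
    (hγ : γ ∈ Set.Ioo (0 : ℝ) 1) (ρ : Fin S → ℝ) {P : X → Matrix (Fin S) (Fin S) ℝ}
    (hP : ∀ x, P x ∈ rowStochastic ℝ (Fin S)) (hcont : Continuous P) (s : Fin S) :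
    Continuous fun x => (ρ ᵥ* potential γ (P x)) s := by
  simp only [vecMul, dotProduct, potential, of_apply]
  refine continuous_finsetSum _ fun i _ => continuous_const.mul ?_
  refine continuous_tsum (fun t => ?_) (summable_geometric_of_lt_one hγ.1.le hγ.2)
    fun t x => norm_pow_mul_pow_apply_le hγ.1.le (hP x) t i s
  exact continuous_const.mul ((hcont.pow t).matrix_elem i s)

/-- The product of a continuous function with a differentiable function vanishing at the point
is differentiable there. -/
lemma hasFDerivAt_mul_of_eq_zero {E : Type*} [NormedAddCommGroup E] [NormedSpace ℝ E]
    {g h : E → ℝ} {h' : E →L[ℝ] ℝ} {x : E} (hg : ContinuousAt g x)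
    (hh : HasFDerivAt h h' x) (hx : h x = 0) :
    HasFDerivAt (fun y => g y * h y) (g x • h') x := by
  rw [hasFDerivAt_iff_isLittleO]
  have h1 : (fun y => g y * (h y - h x - h' (y - x))) =o[𝓝 x] fun y => (1 : ℝ) * ‖y - x‖ :=
    (hg.isBigO_one ℝ).mul_isLittleO hh.isLittleO.norm_right
  have h2 : (fun y => (g y - g x) * h' (y - x)) =o[𝓝 x] fun y => (1 : ℝ) * ‖y - x‖ := by
    refine IsLittleO.mul_isBigO ?_ (h'.isBigO_sub _ _).norm_right
    rw [isLittleO_one_iff]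
    simpa using hg.sub_const (g x)
  have h3 := h1.add h2
  simp only [one_mul, isLittleO_norm_right] at h3
  refine h3.congr_left fun y => ?_
  simp only [hx, _root_.smul_apply, smul_eq_mul]
  ring

lemma hasFDerivAt_lookahead {E : Type*} [NormedAddCommGroup E] [NormedSpace ℝ E]
    (γ : ℝ) (c : Fin S → Fin A → Fin S → ℝ) (π : Fin S → Fin A → ℝ) (v : Fin S → ℝ)
    {p : E → Fin S → Fin A → Fin S → ℝ} {p' : Fin S → Fin A → Fin S → E →L[ℝ] ℝ} {x : E}
    (hp : ∀ s a s', HasFDerivAt (fun y => p y s a s') (p' s a s') x) (s : Fin S) :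
    HasFDerivAt (fun y => lookahead γ c π v (p y) s)
      (∑ a, π s a • ∑ s', (c s a s' + γ * v s') • p' s a s') x :=
  HasFDerivAt.fun_sum fun a _ => (HasFDerivAt.fun_sum fun s' _ =>
    (hp s a s').const_mul _).const_mul _

/-- Transition gradient theorem: gradient of `ξ ↦ J_ρ(π, p^ξ)`. -/
theorem transition_gradient_theorem
    {S A d : ℕ} (hS : 0 < S) (hA : 0 < A)
    (γ : ℝ) (hγ : γ ∈ Set.Ioo (0 : ℝ) 1)
    (c : Fin S → Fin A → Fin S → ℝ)
    (hc : ∀ s a s', c s a s' ∈ Set.Icc (0 : ℝ) 1)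
    (ρ : Fin S → ℝ) (hρ : ρ ∈ stdSimplex ℝ (Fin S))
    (π : Fin S → Fin A → ℝ) (hπ : IsPolicy π)
    -- parametric transition kernel with differentiable coordinates
    (p : EuclideanSpace ℝ (Fin d) → Fin S → Fin A → Fin S → ℝ)
    (hpker : ∀ ξ, IsKernel (p ξ))
    (hpdiff : ∀ s a s', Differentiable ℝ (fun ξ => p ξ s a s')) :
    Differentiable ℝ (fun ξ => J γ c ρ π (p ξ)) ∧
    ∀ ξ : EuclideanSpace ℝ (Fin d),
      gradient (fun ξ' => J γ c ρ π (p ξ')) ξ =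
        (1 / (1 - γ)) •
          ∑ s, occ γ ρ π (p ξ) s •
            ∑ a, π s a •
              ∑ s', (c s a s' + γ * value γ c π (p ξ) s') •
                gradient (fun ξ' => p ξ' s a s') ξ := by
  have hP : ∀ ξ, Pmat π (p ξ) ∈ rowStochastic ℝ (Fin S) :=
    fun ξ => Pmat_mem_rowStochastic hπ (hpker ξ)
  have hcont : Continuous fun ξ => Pmat π (p ξ) :=
    continuous_matrix fun s s' => by
      simp only [Pmat, of_apply]
      exact continuous_finsetSum _ fun a _ => continuous_const.mul (hpdiff s a s').continuous
  have hgrad : ∀ ξ, HasGradientAt (fun ξ' => J γ c ρ π (p ξ'))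
      ((1 / (1 - γ)) • ∑ s, occ γ ρ π (p ξ) s • ∑ a, π s a •
        ∑ s', (c s a s' + γ * value γ c π (p ξ) s') •
          gradient (fun ξ' => p ξ' s a s') ξ) ξ := by
    intro ξ
    have hlook := hasFDerivAt_lookahead γ c π (value γ c π (p ξ))
      fun s a s' => (hpdiff s a s' ξ).hasGradientAt.hasFDerivAt
    have hJ := (HasFDerivAt.fun_sum (u := Finset.univ) fun s _ => hasFDerivAt_mul_of_eq_zero
      (continuous_vecMul_potential hγ ρ hP hcont s).continuousAt
      ((hlook s).sub_const (lookahead γ c π (value γ c π (p ξ)) (p ξ) s))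
      (sub_self _)).const_add (J γ c ρ π (p ξ))
    rw [hasGradientAt_iff_hasFDerivAt,
      funext fun ξ' => J_eq_add_sum hγ c ρ (hP ξ') (hP ξ)]
    refine hJ.congr_fderiv ?_
    have hne : 1 - γ ≠ 0 := (sub_pos.2 hγ.2).ne'
    simp_rw [occ_eq_vecMul_potential hγ ρ (hP ξ), SemigroupAction.mul_smul]
    rw [← Finset.smul_sum, smul_smul, one_div_mul_cancel hne, one_smul]
    simp only [map_sum, map_smulₛₗ, conj_trivial]
  exact ⟨fun ξ => (hgrad ξ).differentiableAt, fun ξ => (hgrad ξ).gradient⟩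

end RMDPStmt
end
end

section
/- Realizing a point along a gradient descent trajectory: let f : ℝ^d → ℝ be continuously differentiable, L-Lipschitz continuous, and ℓ-smooth (i.e., ∇f is ℓ-Lipschitz). Then for every point x̂ ∈ ℝ^d, every step size α > 0, and every index k ≥ 0, there exists a sequence (x_n)_{n≥0} in ℝ^d satisfying x_{n+1} = x_n − α ∇f(x_n) for all n ≥ 0 and x_k = x̂. -/
/-- If `f` is differentiable and Lipschitz, the gradient step `x ↦ x - α • ∇f x` is surjective:
a preimage of `y` is a minimizer of the coercive function `x ↦ ‖x - y‖ ^ 2 / 2 - α * f x`. -/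
theorem exists_sub_smul_gradient_eq {E : Type*} [NormedAddCommGroup E] [InnerProductSpace ℝ E]
    [FiniteDimensional ℝ E] {f : E → ℝ} (hf : Differentiable ℝ f) {L : ℝ}
    (hLip : ∀ x y : E, |f x - f y| ≤ L * ‖x - y‖) {α : ℝ} (hα : 0 ≤ α) (y : E) :
    ∃ x, x - α • gradient f x = y := by
  have hcont : Continuous fun x => ‖x - y‖ ^ 2 / 2 - α * f x := by
    have := hf.continuous
    fun_prop
  have hnorm : Filter.Tendsto (fun x => ‖x - y‖) (Filter.cocompact E) Filter.atTop := by
    simpa only [dist_eq_norm] using tendsto_dist_right_cocompact_atTop y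
  have hcoercive : Filter.Tendsto (fun x => ‖x - y‖ ^ 2 / 2 - α * f x)
      (Filter.cocompact E) Filter.atTop := by
    have hlinear := Filter.tendsto_atTop_add_const_right _ (-(α * f y)) hnorm
    refine Filter.tendsto_atTop_mono' _ ?_ hlinear
    filter_upwards [hnorm.eventually_ge_atTop (2 * (1 + α * L))] with x hx
    have hbound := mul_le_mul_of_nonneg_left ((le_abs_self _).trans (hLip x y)) hα
    nlinarith [mul_nonneg (norm_nonneg (x - y)) (sub_nonneg.2 hx)]
  obtain ⟨x, hx⟩ := hcont.exists_forall_le hcoercive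
  refine ⟨x, ext_inner_right ℝ fun v => ?_⟩
  have hderiv := (((hasFDerivAt_id x).sub_const y).norm_sq.const_mul (1 / 2 : ℝ)).sub
    ((hf x).hasGradientAt.hasFDerivAt.const_mul α)
  have hmin : IsLocalMin (fun x => 1 / 2 * ‖id x - y‖ ^ 2 - α * f x) x :=
    Filter.Eventually.of_forall fun z => by
      have := hx z
      simp only [id]
      linarith
  have hzero := congrArg (fun φ : E →L[ℝ] ℝ => φ v) (hmin.hasFDerivAt_eq_zero hderiv)
  have hinner : inner ℝ (x - y) v - α * inner ℝ (gradient f x) v = 0 := by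
    simpa [inner_sub_left] using hzero
  rw [inner_sub_left] at hinner ⊢
  rw [real_inner_smul_left]
  linarith

/-- Realizing a point along a gradient descent trajectory: if `f : ℝ^d → ℝ` is
continuously differentiable, `L`-Lipschitz, and `ℓ`-smooth (its gradient is
`ℓ`-Lipschitz), then for every `x̂`, every step size `α > 0`, and every index
`k`, there is a gradient descent trajectory whose `k`-th iterate is `x̂`. -/
theorem exists_gradient_descent_sequence_through_point
    {d : ℕ} (f : EuclideanSpace ℝ (Fin d) → ℝ) (L ℓ : ℝ)
    (hf : ContDiff ℝ 1 f)
    (hLip : ∀ x y : EuclideanSpace ℝ (Fin d), |f x - f y| ≤ L * ‖x - y‖)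
    (hSmooth : ∀ x y : EuclideanSpace ℝ (Fin d),
      ‖gradient f x - gradient f y‖ ≤ ℓ * ‖x - y‖) :
    ∀ (xhat : EuclideanSpace ℝ (Fin d)) (α : ℝ), 0 < α → ∀ k : ℕ,
      ∃ x : ℕ → EuclideanSpace ℝ (Fin d),
        (∀ n, x (n + 1) = x n - α • gradient f (x n)) ∧ x k = xhat := by
  intro xhat α hα k
  induction k generalizing xhat with
  | zero =>
    exact ⟨fun n => (fun x => x - α • gradient f x)^[n] xhat,
      fun n => Function.iterate_succ_apply' _ n xhat, rfl⟩
  | succ k ih =>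
    obtain ⟨y, hy⟩ :=
      exists_sub_smul_gradient_eq (hf.differentiable one_ne_zero) hLip hα.le xhat
    obtain ⟨x, hstep, hxk⟩ := ih y
    exact ⟨x, hstep, by rw [hstep, hxk, hy]⟩
end
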